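/- Let n ≥ 1, let A be a symmetric positive definite n×n real matrix with inverse C := A⁻¹, let y₀ ∈ ℝⁿ be a unit vector, and let u₁,…,uₙ be an orthonormal basis of ℝⁿ with βᵢ := ⟨uᵢ, y₀⟩ > 0 for all i. Then 2ⁿ·√(det A)·(Πⱼ βⱼ)·Σᵢ √(uᵢᵀ C uᵢ)/βᵢ ≤ 2ⁿ · n^{−(n−2)/2} · √(det A) · √(tr C). -/

import Mathlib

open Matrix

lemma tangent_pow (k : ℕ) (a m : ℝ) (ha : 0 ≤ a) (hm : 0 ≤ m) :
    a ^ (k + 1) + (k + 1) * a ^ k * (m - a) ≤ m ^ (k + 1) := by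
  induction k with
  | zero => simp
  | succ k ih =>
    have h1 := mul_le_mul_of_nonneg_left ih hm
    have h2 : 0 ≤ ((k : ℝ) + 1) * a ^ k * (m - a) ^ 2 := by positivity
    push_cast
    have e : m ^ (k + 1 + 1) = m * m ^ (k + 1) := by ring
    rw [e]
    refine le_trans ?_ h1
    have e2 : m * (a ^ (k + 1) + (k + 1) * a ^ k * (m - a)) -
      (a ^ (k + 1 + 1) + ((k : ℝ) + 1 + 1) * a ^ (k + 1) * (m - a)) =
      ((k : ℝ) + 1) * a ^ k * (m - a) ^ 2 := by ring
    linarith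

lemma maclaurin_aux (n : ℕ) (x : Fin (n + 1) → ℝ) (hx : ∀ i, 0 < x i) :
    (∏ i, x i) ≤ ((∑ i, x i) / (n + 1)) ^ (n + 1) ∧
    (∏ i, x i) * ∑ i, 1 / x i ≤ (n + 1) * ((∑ i, x i) / (n + 1)) ^ n := by
  induction n with
  | zero =>
    have := (hx 0).ne'
    simp [this]
  | succ n ih =>
    obtain ⟨h1, h2⟩ := ih (fun i => x i.succ) (fun i => hx _)
    rw [Fin.prod_univ_succ, Fin.sum_univ_succ, Fin.sum_univ_succ (f := fun i => 1 / x i)]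
    have hS : 0 < ∑ i : Fin (n + 1), x i.succ :=
      Finset.sum_pos (fun i _ => hx _) Finset.univ_nonempty
    have ht := hx 0
    generalize x 0 = t at *
    generalize (∑ i : Fin (n + 1), x i.succ) = S at *
    generalize (∏ i : Fin (n + 1), x i.succ) = P at *
    generalize (∑ i : Fin (n + 1), 1 / x i.succ) = R at *
    have hn : (0 : ℝ) < n + 1 := by positivity
    obtain ⟨a, ha⟩ : ∃ a, a = S / (n + 1) := ⟨_, rfl⟩
    obtain ⟨m, hm⟩ : ∃ m, m = (t + S) / (((n + 1 : ℕ) : ℝ) + 1) := ⟨_, rfl⟩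
    rw [← ha] at h1 h2
    rw [← hm]
    have ha0 : 0 ≤ a := by rw [ha]; positivity
    have hm0 : 0 ≤ m := by rw [hm]; positivity
    have hSa : S = (n + 1) * a := by rw [ha]; field_simp
    have htm : t = (n + 2) * m - (n + 1) * a := by
      rw [← hSa, hm]; push_cast; field_simp; ring
    push_cast
    constructor
    · have h3 := mul_le_mul_of_nonneg_left h1 ht.le
      refine h3.trans ?_
      have h4 := tangent_pow (n + 1) a m ha0 hm0
      push_cast at h4
      refine le_trans (le_of_eq ?_) h4
      rw [htm]; ring
    · have h3 := mul_le_mul_of_nonneg_left h2 ht.le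
      have h4 := mul_le_mul_of_nonneg_left (tangent_pow n a m ha0 hm0)
        (by positivity : (0 : ℝ) ≤ n + 2)
      have e : t * P * (1 / t + R) = P + t * (P * R) := by field_simp
      rw [e]
      have e2 : a ^ (n + 1) + t * ((n + 1) * a ^ n) =
        (n + 2) * (a ^ (n + 1) + (n + 1) * a ^ n * (m - a)) := by rw [htm]; ring
      have e3 : ((n : ℝ) + 1 + 1) = n + 2 := by ring
      rw [e3]
      linarith

theorem vertex_constrained_facet_area_le
    (n : ℕ) (hn : 1 ≤ n) (A : Matrix (Fin n) (Fin n) ℝ) (hA : A.PosDef)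
    (C : Matrix (Fin n) (Fin n) ℝ) (hC : C = A⁻¹)
    (y₀ : Fin n → ℝ) (hy₀ : y₀ ⬝ᵥ y₀ = 1)
    (u : Fin n → Fin n → ℝ)
    (hu : ∀ i j, u i ⬝ᵥ u j = if i = j then 1 else 0)
    (β : Fin n → ℝ) (hβ : ∀ i, β i = u i ⬝ᵥ y₀)
    (hβpos : ∀ i, 0 < β i) :
    (2 : ℝ) ^ n * Real.sqrt A.det * (∏ j, β j) *
        ∑ i, Real.sqrt (u i ⬝ᵥ C.mulVec (u i)) / β i ≤
      (2 : ℝ) ^ n * (n : ℝ) ^ (-(((n : ℝ) - 2) / 2)) *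
        Real.sqrt A.det * Real.sqrt C.trace := by
  have hCpos : C.PosDef := hC ▸ hA.inv
  let U : Matrix (Fin n) (Fin n) ℝ := Matrix.of u
  have hU : U * Uᵀ = 1 := by
    ext i j
    rw [Matrix.mul_apply, Matrix.one_apply, ← hu i j]
    rfl
  have hU' : Uᵀ * U = 1 := mul_eq_one_comm.mp hU
  have hβU : β = U *ᵥ y₀ := by
    funext i; rw [hβ]; rfl
  have hβ2 : ∑ i, β i ^ 2 = 1 := by
    have : β ⬝ᵥ β = 1 := by
      rw [hβU, Matrix.dotProduct_mulVec, ← Matrix.mulVec_transpose, Matrix.mulVec_mulVec, hU',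
        Matrix.one_mulVec, hy₀]
    rw [← this]
    simp [dotProduct, sq]
  have htr : ∑ i, u i ⬝ᵥ C.mulVec (u i) = C.trace := by
    have : (U * C * Uᵀ).trace = C.trace := by
      rw [Matrix.trace_mul_comm, ← Matrix.mul_assoc, hU', Matrix.one_mul]
    rw [← this, Matrix.mul_assoc]
    rfl
  have hc0 : ∀ i, 0 ≤ u i ⬝ᵥ C.mulVec (u i) := fun i => by
    have := hCpos.posSemidef.dotProduct_mulVec_nonneg (u i)
    simpa using this
  obtain ⟨k, rfl⟩ : ∃ k, n = k + 1 := ⟨n - 1, by omega⟩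
  have hP : 0 < ∏ j, β j := Finset.prod_pos fun i _ => hβpos i
  have hmac := (maclaurin_aux k (fun i => β i ^ 2) (fun i => pow_pos (hβpos i) 2)).2
  rw [hβ2, Finset.prod_pow] at hmac
  have hcs := Real.sum_mul_le_sqrt_mul_sqrt Finset.univ
    (fun i => Real.sqrt (u i ⬝ᵥ C.mulVec (u i))) (fun i => 1 / β i)
  have hcs1 : ∑ i, Real.sqrt (u i ⬝ᵥ C.mulVec (u i)) ^ 2 = C.trace := by
    rw [← htr]
    exact Finset.sum_congr rfl fun i _ => Real.sq_sqrt (hc0 i)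
  rw [hcs1] at hcs
  have hr : (∏ j, β j) * Real.sqrt (∑ i, (1 / β i) ^ 2) ≤
      ((k + 1 : ℕ) : ℝ) ^ (-((((k + 1 : ℕ) : ℝ) - 2) / 2)) := by
    refine le_of_pow_le_pow_left₀ two_ne_zero (by positivity) ?_
    rw [mul_pow, Real.sq_sqrt (by positivity), ← Real.rpow_natCast _ 2, ← Real.rpow_natCast (_ ^ _) 2,
      ← Real.rpow_mul (by positivity)]
    have e : -((((k + 1 : ℕ) : ℝ) - 2) / 2) * ((2 : ℕ) : ℝ) = 1 - (k : ℝ) := by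
      push_cast; ring
    rw [e, Real.rpow_sub (by positivity), Real.rpow_one, Real.rpow_natCast, Real.rpow_natCast]
    simp only [div_pow, one_pow] at hmac ⊢
    push_cast
    refine hmac.trans (le_of_eq ?_)
    ring
  have hmain : (∏ j, β j) * ∑ i, Real.sqrt (u i ⬝ᵥ C.mulVec (u i)) / β i ≤
      ((k + 1 : ℕ) : ℝ) ^ (-((((k + 1 : ℕ) : ℝ) - 2) / 2)) * Real.sqrt C.trace := by
    have e : ∑ i, Real.sqrt (u i ⬝ᵥ C.mulVec (u i)) / β i =
        ∑ i, Real.sqrt (u i ⬝ᵥ C.mulVec (u i)) * (1 / β i) :=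
      Finset.sum_congr rfl fun i _ => by ring
    rw [e]
    have h1 := mul_le_mul_of_nonneg_left hcs hP.le
    have h2 := mul_le_mul_of_nonneg_right hr (Real.sqrt_nonneg C.trace)
    linarith
  have h3 := mul_le_mul_of_nonneg_left hmain
    (by positivity : 0 ≤ (2 : ℝ) ^ (k + 1) * Real.sqrt A.det)
  linarith
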